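/- arXiv:1510.00430 — 3 statements merged into one kernel-verified Lean document; each statement's English description precedes it below -/
import Mathlib

section
/- Let D = D1 × D2 ⊆ ℂ × ℂ be an open polydisc, let Z be a nonvanishing holomorphic function on D1, W a nonvanishing holomorphic function on D2, and H a holomorphic function on D with H_z and H_w nonvanishing. Set a(z,w) = Z(z)W(w)H_z(z,w), b(z,w) = Z(z)W(w)H_w(z,w), A = ∂_z(a_w/a), B = ∂_w(b_z/b), and assume A − B is nonvanishing on D; define ξ = (1/(A−B))·[ a·∂_z((b/a)·B) − b·∂_w((a/b)·A) ]. Then ∂_z(ξ/a) = A and ∂_w(ξ/b) = B hold on D. -/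
noncomputable section

/-- Partial derivative in the first (`z`) variable. -/
def pz (F : ℂ × ℂ → ℂ) (p : ℂ × ℂ) : ℂ := fderiv ℂ F p (1, 0)

/-- Partial derivative in the second (`w`) variable. -/
def pw (F : ℂ × ℂ → ℂ) (p : ℂ × ℂ) : ℂ := fderiv ℂ F p (0, 1)

/-- A 1-form `P dz + Q dw` given by its pair of coefficient functions. -/
abbrev Form1 := (ℂ × ℂ → ℂ) × (ℂ × ℂ → ℂ)

/-- A 1-form is holomorphic on `U` if both coefficients are. -/
def HoloForm (ω : Form1) (U : Set (ℂ × ℂ)) : Prop :=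
  DifferentiableOn ℂ ω.1 U ∧ DifferentiableOn ℂ ω.2 U

/-- Wedge product of two 1-forms (coefficient of `dz ∧ dw`). -/
def wedge (ω ω' : Form1) (p : ℂ × ℂ) : ℂ := ω.1 p * ω'.2 p - ω.2 p * ω'.1 p

/-- Exterior derivative `Q_z - P_w` of `P dz + Q dw` (coefficient of `dz ∧ dw`). -/
def dForm (ω : Form1) (p : ℂ × ℂ) : ℂ := pz ω.2 p - pw ω.1 p

/-- A 1-form `P dz + Q dw` is closed on `V` if `P_w = Q_z` there. -/
def IsClosed1 (ω : Form1) (V : Set (ℂ × ℂ)) : Prop := ∀ p ∈ V, pw ω.1 p = pz ω.2 p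

/-- The differential of a function, as a 1-form. -/
def dfun (φ : ℂ × ℂ → ℂ) : Form1 := (pz φ, pw φ)

def addF (ω ω' : Form1) : Form1 := (fun p => ω.1 p + ω'.1 p, fun p => ω.2 p + ω'.2 p)
def subF (ω ω' : Form1) : Form1 := (fun p => ω.1 p - ω'.1 p, fun p => ω.2 p - ω'.2 p)
def fsmul (h : ℂ × ℂ → ℂ) (ω : Form1) : Form1 :=
  (fun p => h p * ω.1 p, fun p => h p * ω.2 p)
def csmul (c : ℂ) (ω : Form1) : Form1 := (fun p => c * ω.1 p, fun p => c * ω.2 p)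

/-- Coefficients of the symmetric product of three 1-forms. -/
def symC0 (a b c : Form1) (p : ℂ × ℂ) : ℂ := a.1 p * b.1 p * c.1 p
def symC1 (a b c : Form1) (p : ℂ × ℂ) : ℂ :=
  a.1 p * b.1 p * c.2 p + a.1 p * b.2 p * c.1 p + a.2 p * b.1 p * c.1 p
def symC2 (a b c : Form1) (p : ℂ × ℂ) : ℂ :=
  a.1 p * b.2 p * c.2 p + a.2 p * b.1 p * c.2 p + a.2 p * b.2 p * c.1 p
def symC3 (a b c : Form1) (p : ℂ × ℂ) : ℂ := a.2 p * b.2 p * c.2 p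

/-- The symmetric 3-differential `c0 dz³ + c1 dz²dw + c2 dz dw² + c3 dw³` is
non-degenerate at `x` if the binary cubic `c0 s³ + c1 s²t + c2 st² + c3 t³` is nonzero
and has three pairwise non-proportional roots in the projective line. -/
def NonDegAt (c0 c1 c2 c3 : ℂ × ℂ → ℂ) (x : ℂ × ℂ) : Prop :=
  (c0 x ≠ 0 ∨ c1 x ≠ 0 ∨ c2 x ≠ 0 ∨ c3 x ≠ 0) ∧
  ∃ r : Fin 3 → ℂ × ℂ,
    (∀ i j, i ≠ j → (r i).1 * (r j).2 - (r i).2 * (r j).1 ≠ 0) ∧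
    (∀ i, c0 x * (r i).1 ^ 3 + c1 x * (r i).1 ^ 2 * (r i).2 +
          c2 x * (r i).1 * (r i).2 ^ 2 + c3 x * (r i).2 ^ 3 = 0)

/-- A symmetric 3-differential is closed at `x` if on some open neighborhood of `x`
(inside `U`) it is a symmetric product of three closed holomorphic 1-forms. -/
def ClosedAt (U : Set (ℂ × ℂ)) (c0 c1 c2 c3 : ℂ × ℂ → ℂ) (x : ℂ × ℂ) : Prop :=
  ∃ V : Set (ℂ × ℂ), IsOpen V ∧ x ∈ V ∧ V ⊆ U ∧
    ∃ z1 z2 z3 : Form1,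
      HoloForm z1 V ∧ HoloForm z2 V ∧ HoloForm z3 V ∧
      IsClosed1 z1 V ∧ IsClosed1 z2 V ∧ IsClosed1 z3 V ∧
      ∀ p ∈ V, c0 p = symC0 z1 z2 z3 p ∧ c1 p = symC1 z1 z2 z3 p ∧
               c2 p = symC2 z1 z2 z3 p ∧ c3 p = symC3 z1 z2 z3 p

/-- `D1 × D2` is an open polydisc. -/
def IsPolydisc (D1 D2 : Set ℂ) : Prop :=
  ∃ z0 w0 : ℂ, ∃ r1 r2 : ℝ, 0 < r1 ∧ 0 < r2 ∧
    D1 = Metric.ball z0 r1 ∧ D2 = Metric.ball w0 r2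

/-- `A = ∂_z(a_w/a)`. -/
def Afun (a : ℂ × ℂ → ℂ) : ℂ × ℂ → ℂ := pz (fun p => pw a p / a p)

/-- `B = ∂_w(b_z/b)`. -/
def Bfun (b : ℂ × ℂ → ℂ) : ℂ × ℂ → ℂ := pw (fun p => pz b p / b p)

/-- `ξ = (1/(A−B))·[ a·∂_z((b/a)·B) − b·∂_w((a/b)·A) ]`. -/
def xifun (a b : ℂ × ℂ → ℂ) : ℂ × ℂ → ℂ := fun p =>
  (Afun a p - Bfun b p)⁻¹ *
    (a p * pz (fun q => b q / a q * Bfun b q) p -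
     b p * pw (fun q => a q / b q * Afun a q) p)

open Metric MeasureTheory in
/-- A directional derivative of a holomorphic function of several variables is holomorphic. -/
theorem differentiableOn_fderiv_apply_const {E : Type*} [NormedAddCommGroup E] [NormedSpace ℂ E]
    [FiniteDimensional ℂ E] {F : E → ℂ} {U : Set E} (hU : IsOpen U)
    (hF : DifferentiableOn ℂ F U) (v : E) :
    DifferentiableOn ℂ (fun p => fderiv ℂ F p v) U := by
  intro p₀ hp₀
  have : ProperSpace E := FiniteDimensional.proper ℂ E
  borelize E
  obtain ⟨r, hr, hrU, hrF⟩ : ∃ r > 0, ball p₀ r ⊆ U ∧ ∀ q ∈ ball p₀ r, dist (F q) (F p₀) < 1 := by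
    have h₁ := (hF.continuousOn.continuousAt (hU.mem_nhds hp₀)).eventually (ball_mem_nhds _ one_pos)
    obtain ⟨r, hr, h⟩ := Metric.mem_nhds_iff.1 (Filter.inter_mem (hU.mem_nhds hp₀) h₁)
    exact ⟨r, hr, fun q hq => (h hq).1, fun q hq => (h hq).2⟩
  have hd : ∀ q ∈ ball p₀ r, DifferentiableAt ℂ F q := fun q hq =>
    hF.differentiableAt (hU.mem_nhds (hrU hq))
  have hbound : ∀ q ∈ ball p₀ (r / 2), ‖fderiv ℂ F q‖ ≤ 2 / (r / 2) := by
    intro q hq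
    have hsub : ball q (r / 2) ⊆ ball p₀ r :=
      ball_subset_ball' (by rw [mem_ball] at hq; linarith)
    refine Complex.norm_fderiv_le_div_of_mapsTo_ball (hF.mono (hsub.trans hrU)) ?_ (by positivity)
    intro x hx
    have h₁ := hrF x (hsub hx)
    have h₂ := hrF q (hsub (mem_ball_self (by positivity)))
    rw [mem_closedBall]
    linarith [dist_triangle_right (F x) (F q) (F p₀)]
  obtain ⟨ρ, hρ, hρv⟩ : ∃ ρ : ℝ, 0 < ρ ∧ ρ * ‖v‖ < r / 4 := by
    refine ⟨r / 4 / (‖v‖ + 1), by positivity, ?_⟩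
    rw [div_mul_eq_mul_div, div_lt_iff₀ (by positivity)]
    nlinarith
  have hmem : ∀ p ∈ ball p₀ (r / 4), ∀ ζ : ℂ, ‖ζ‖ ≤ ρ → p + ζ • v ∈ ball p₀ (r / 2) := by
    intro p hp ζ hζ
    rw [mem_ball, dist_eq_norm] at hp ⊢
    calc ‖p + ζ • v - p₀‖ = ‖(p - p₀) + ζ • v‖ := by congr 1; abel
      _ ≤ ‖p - p₀‖ + ‖ζ‖ * ‖v‖ := (norm_add_le _ _).trans_eq (by rw [norm_smul])
      _ ≤ ‖p - p₀‖ + ρ * ‖v‖ := by gcongr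
      _ < r / 2 := by linarith
  have hhalf : ball p₀ (r / 2) ⊆ ball p₀ r := ball_subset_ball (by linarith)
  have hcirc : ∀ θ : ℝ, ‖circleMap 0 ρ θ‖ = ρ := fun θ => by simp [abs_of_pos hρ]
  set k : ℝ → ℂ := fun θ => deriv (circleMap 0 ρ) θ * (1 / (circleMap 0 ρ θ) ^ 2) with hk
  have hkc : Continuous k := by
    have h₀ : ∀ θ, circleMap 0 ρ θ ^ 2 ≠ 0 := fun θ =>
      pow_ne_zero 2 (circleMap_ne_center hρ.ne')
    simp only [hk, deriv_circleMap]
    exact ((continuous_circleMap 0 ρ).mul continuous_const).mul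
      (continuous_const.div ((continuous_circleMap 0 ρ).pow 2) h₀)
  have hFc : ∀ p ∈ ball p₀ (r / 4), Continuous fun θ => k θ * F (p + circleMap 0 ρ θ • v) := by
    intro p hp
    refine hkc.mul (continuous_iff_continuousAt.2 fun θ => ?_)
    have h₁ := (hd _ (hhalf (hmem p hp _ (hcirc θ).le))).continuousAt
    exact ContinuousAt.comp (f := fun θ => p + circleMap 0 ρ θ • v) h₁
      (by have := continuous_circleMap 0 ρ; fun_prop)
  have hcauchy : ∀ p ∈ ball p₀ (r / 4), fderiv ℂ F p v =
      (2 * Real.pi * Complex.I)⁻¹ *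
        ∫ θ in (0 : ℝ)..2 * Real.pi, k θ * F (p + circleMap 0 ρ θ • v) := by
    intro p hp
    have hline : ∀ ζ : ℂ, HasDerivAt (fun ζ : ℂ => p + ζ • v) v ζ := fun ζ => by
      simpa using ((hasDerivAt_id ζ).smul_const v).const_add p
    have hdiff : DifferentiableOn ℂ (fun ζ : ℂ => F (p + ζ • v)) (closedBall 0 ρ) := by
      intro ζ hζ
      refine ((hd _ (hhalf (hmem p hp ζ (by simpa using hζ)))).comp
        (f := fun ζ : ℂ => p + ζ • v) ζ
        (hline ζ).differentiableAt).differentiableWithinAt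
    have h₁ := hdiff.deriv_eq_smul_circleIntegral hρ
    have h₂ : deriv (fun ζ : ℂ => F (p + ζ • v)) 0 = fderiv ℂ F p v := by
      have hp' : HasFDerivAt F (fderiv ℂ F p) (p + (0 : ℂ) • v) := by
        rw [zero_smul, add_zero]
        exact (hd p (ball_subset_ball (by linarith) hp)).hasFDerivAt
      exact (hp'.comp_hasDerivAt (0 : ℂ) (hline 0)).deriv
    rw [h₂] at h₁
    rw [eq_inv_mul_iff_mul_eq₀ Complex.two_pi_I_ne_zero, ← smul_eq_mul, ← h₁]
    simp [circleIntegral, hk, mul_assoc]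
  have hnhds : ball p₀ (r / 4) ∈ nhds p₀ := ball_mem_nhds _ (by positivity)
  have hp₀' : p₀ ∈ ball p₀ (r / 4) := mem_ball_self (by positivity)
  have hint := intervalIntegral.hasFDerivAt_integral_of_dominated_of_fderiv_le (𝕜 := ℂ)
    (μ := volume) (a := 0) (b := 2 * Real.pi)
    (F := fun p θ => k θ * F (p + circleMap 0 ρ θ • v))
    (F' := fun p θ => k θ • fderiv ℂ F (p + circleMap 0 ρ θ • v))
    (bound := fun θ => ‖k θ‖ * (2 / (r / 2))) hnhds
    (Filter.eventually_of_mem hnhds fun p hp => (hFc p hp).aestronglyMeasurable)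
    ((hFc p₀ hp₀').intervalIntegrable _ _)
    (by
      refine hkc.aestronglyMeasurable.smul ?_
      have h₁ : Measurable fun θ => fderiv ℂ F (p₀ + circleMap 0 ρ θ • v) :=
        (measurable_fderiv ℂ F).comp
          (by have := continuous_circleMap 0 ρ; fun_prop :
            Continuous fun θ => p₀ + circleMap 0 ρ θ • v).measurable
      exact h₁.aestronglyMeasurable)
    (by
      refine Filter.Eventually.of_forall fun θ _ p hp => ?_
      rw [norm_smul]
      gcongr
      exact hbound _ (hmem p hp _ (hcirc θ).le))
    ((hkc.norm.mul continuous_const).intervalIntegrable _ _)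
    (by
      refine Filter.Eventually.of_forall fun θ _ p hp => ?_
      have h₁ := (hd _ (hhalf (hmem p hp _ (hcirc θ).le))).hasFDerivAt
      exact (HasFDerivAt.comp p (f := fun p => p + circleMap 0 ρ θ • v) h₁
        ((hasFDerivAt_id p).add_const _)).const_mul _)
  refine DifferentiableAt.differentiableWithinAt ?_
  refine (hint.differentiableAt.const_mul (2 * Real.pi * Complex.I)⁻¹).congr_of_eventuallyEq ?_
  exact Filter.eventually_of_mem hnhds hcauchy

/-- The partial derivative `pz` of a holomorphic function is holomorphic. -/
theorem differentiableOn_pz {F : ℂ × ℂ → ℂ} {U : Set (ℂ × ℂ)} (hU : IsOpen U)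
    (hF : DifferentiableOn ℂ F U) : DifferentiableOn ℂ (pz F) U :=
  differentiableOn_fderiv_apply_const hU hF _

/-- The partial derivative `pw` of a holomorphic function is holomorphic. -/
theorem differentiableOn_pw {F : ℂ × ℂ → ℂ} {U : Set (ℂ × ℂ)} (hU : IsOpen U)
    (hF : DifferentiableOn ℂ F U) : DifferentiableOn ℂ (pw F) U :=
  differentiableOn_fderiv_apply_const hU hF _

/-- Mixed partial derivatives of a holomorphic function commute. -/
theorem pz_pw_comm {F : ℂ × ℂ → ℂ} {U : Set (ℂ × ℂ)} (hU : IsOpen U)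
    (hF : DifferentiableOn ℂ F U) : Set.EqOn (pz (pw F)) (pw (pz F)) U := by
  intro p hp
  have hUp := hU.mem_nhds hp
  have hsplit : fderiv ℂ F = fun q =>
      pz F q • ContinuousLinearMap.fst ℂ ℂ ℂ + pw F q • ContinuousLinearMap.snd ℂ ℂ ℂ := by
    ext q <;> simp [pz, pw]
  have hd : DifferentiableAt ℂ (fderiv ℂ F) p := by
    rw [hsplit]
    exact (((differentiableOn_pz hU hF).differentiableAt hUp).smul_const _).add
      (((differentiableOn_pw hU hF).differentiableAt hUp).smul_const _)
  have h := second_derivative_symmetric_of_eventually (𝕜 := ℂ)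
    (Filter.eventually_of_mem hUp fun q hq => (hF.differentiableAt (hU.mem_nhds hq)).hasFDerivAt)
    hd.hasFDerivAt (1, 0) (0, 1)
  have happly : ∀ v w : ℂ × ℂ,
      fderiv ℂ (fun q => fderiv ℂ F q w) p v = fderiv ℂ (fderiv ℂ F) p v w := fun v w => by
    rw [fderiv_clm_apply hd (differentiableAt_const w)]
    simp
  exact (happly _ _).trans (h.trans (happly _ _).symm)

theorem fderiv_mul_apply {f g : ℂ × ℂ → ℂ} {p : ℂ × ℂ} (hf : DifferentiableAt ℂ f p)
    (hg : DifferentiableAt ℂ g p) (v : ℂ × ℂ) :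
    fderiv ℂ (fun q => f q * g q) p v = fderiv ℂ f p v * g p + f p * fderiv ℂ g p v := by
  rw [fderiv_fun_mul hf hg]
  simp
  ring

theorem differentiableAt_div {f g : ℂ × ℂ → ℂ} {p : ℂ × ℂ} (hf : DifferentiableAt ℂ f p)
    (hg : DifferentiableAt ℂ g p) (hg₀ : g p ≠ 0) : DifferentiableAt ℂ (fun q => f q / g q) p := by
  simp only [div_eq_mul_inv]
  exact hf.fun_mul (hg.fun_inv hg₀)

theorem fderiv_div_apply {f g : ℂ × ℂ → ℂ} {p : ℂ × ℂ} (hf : DifferentiableAt ℂ f p)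
    (hg : DifferentiableAt ℂ g p) (hg₀ : g p ≠ 0) (v : ℂ × ℂ) :
    fderiv ℂ (fun q => f q / g q) p v =
      (fderiv ℂ f p v * g p - f p * fderiv ℂ g p v) / g p ^ 2 := by
  have h : fderiv ℂ f p v = fderiv ℂ (fun q => f q / g q) p v * g p +
      f p / g p * fderiv ℂ g p v := by
    rw [← fderiv_mul_apply (differentiableAt_div hf hg hg₀) hg]
    have he : f =ᶠ[nhds p] fun q => f q / g q * g q := by
      filter_upwards [hg.continuousAt.eventually_ne hg₀] with q hq
      field_simp
    rw [he.fderiv_eq]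
  rw [h]
  field_simp
  ring

theorem fderiv_mul_sub_mul_div_mul_apply {f₁ f₂ f₃ f₄ g₁ g₂ : ℂ × ℂ → ℂ} {p : ℂ × ℂ}
    (h₁ : DifferentiableAt ℂ f₁ p) (h₂ : DifferentiableAt ℂ f₂ p) (h₃ : DifferentiableAt ℂ f₃ p)
    (h₄ : DifferentiableAt ℂ f₄ p) (hg₁ : DifferentiableAt ℂ g₁ p) (hg₂ : DifferentiableAt ℂ g₂ p)
    (hne₁ : g₁ p ≠ 0) (hne₂ : g₂ p ≠ 0) (v : ℂ × ℂ) :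
    fderiv ℂ (fun q => (f₁ q * f₂ q - f₃ q * f₄ q) / (g₁ q * g₂ q)) p v =
      ((fderiv ℂ f₁ p v * f₂ p + f₁ p * fderiv ℂ f₂ p v -
          (fderiv ℂ f₃ p v * f₄ p + f₃ p * fderiv ℂ f₄ p v)) * (g₁ p * g₂ p) -
        (f₁ p * f₂ p - f₃ p * f₄ p) * (fderiv ℂ g₁ p v * g₂ p + g₁ p * fderiv ℂ g₂ p v)) /
      (g₁ p * g₂ p) ^ 2 := by
  rw [fderiv_div_apply ((h₁.fun_mul h₂).fun_sub (h₃.fun_mul h₄)) (hg₁.fun_mul hg₂)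
    (mul_ne_zero hne₁ hne₂), fderiv_fun_sub (h₁.fun_mul h₂) (h₃.fun_mul h₄),
    sub_apply, fderiv_mul_apply h₁ h₂, fderiv_mul_apply h₃ h₄,
    fderiv_mul_apply hg₁ hg₂]

theorem pz_congr {f g : ℂ × ℂ → ℂ} {U : Set (ℂ × ℂ)} (hU : IsOpen U) (h : Set.EqOn f g U) :
    Set.EqOn (pz f) (pz g) U := fun p hp => by
  simp only [pz, (h.eventuallyEq_of_mem (hU.mem_nhds hp)).fderiv_eq]

theorem pw_congr {f g : ℂ × ℂ → ℂ} {U : Set (ℂ × ℂ)} (hU : IsOpen U) (h : Set.EqOn f g U) :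
    Set.EqOn (pw f) (pw g) U := fun p hp => by
  simp only [pw, (h.eventuallyEq_of_mem (hU.mem_nhds hp)).fderiv_eq]

/-- The logarithmic derivative `a_w / a` of `a = Z(z) W(w) h` has the same `z`-derivative
as `h_w / h`. -/
theorem Afun_weight_mul {D1 D2 : Set ℂ} (hD1 : IsOpen D1) (hD2 : IsOpen D2) {Z W : ℂ → ℂ}
    (hZ : DifferentiableOn ℂ Z D1) (hZ0 : ∀ z ∈ D1, Z z ≠ 0)
    (hW : DifferentiableOn ℂ W D2) (hW0 : ∀ w ∈ D2, W w ≠ 0) {h : ℂ × ℂ → ℂ}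
    (hh : DifferentiableOn ℂ h (D1 ×ˢ D2)) (hh0 : ∀ p ∈ D1 ×ˢ D2, h p ≠ 0) :
    Set.EqOn (Afun fun p => Z p.1 * W p.2 * h p) (pz fun p => pw h p / h p) (D1 ×ˢ D2) := by
  have hU := hD1.prod hD2
  have hlog : Set.EqOn
      (fun p => pw (fun p => Z p.1 * W p.2 * h p) p / (Z p.1 * W p.2 * h p))
      (fun p => deriv W p.2 / W p.2 + pw h p / h p) (D1 ×ˢ D2) := by
    intro p hp
    have hZp := hZ0 _ hp.1
    have hWp := hW0 _ hp.2
    have hhp := hh0 p hp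
    have h₁ := ((hZ.differentiableAt (hD1.mem_nhds hp.1)).hasDerivAt.hasFDerivAt.comp p
      hasFDerivAt_fst).mul ((hW.differentiableAt (hD2.mem_nhds hp.2)).hasDerivAt.hasFDerivAt.comp p
      hasFDerivAt_snd) |>.mul (hh.differentiableAt (hU.mem_nhds hp)).hasFDerivAt
    have h₂ : pw (fun p => Z p.1 * W p.2 * h p) p =
        Z p.1 * W p.2 * pw h p + h p * (Z p.1 * deriv W p.2) := by
      refine (DFunLike.congr_fun h₁.fderiv ((0 : ℂ), (1 : ℂ))).trans ?_
      simp [pw]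
    simp only [h₂]
    field_simp
    ring
  intro p hp
  refine (pz_congr hU hlog hp).trans ?_
  have h₁ : DifferentiableAt ℂ (fun w => deriv W w / W w) p.2 :=
    ((hW.deriv hD2).differentiableAt (hD2.mem_nhds hp.2)).fun_div
      (hW.differentiableAt (hD2.mem_nhds hp.2)) (hW0 _ hp.2)
  have h₂ := h₁.hasFDerivAt.comp p hasFDerivAt_snd
  have h₃ : DifferentiableAt ℂ (fun p => pw h p / h p) p :=
    differentiableAt_div ((differentiableOn_pw hU hh).differentiableAt (hU.mem_nhds hp))
      (hh.differentiableAt (hU.mem_nhds hp)) (hh0 p hp)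
  refine (DFunLike.congr_fun (h₂.add h₃.hasFDerivAt).fderiv ((1 : ℂ), (0 : ℂ))).trans ?_
  simp [pz]

/-- The logarithmic derivative `b_z / b` of `b = Z(z) W(w) h` has the same `w`-derivative
as `h_z / h`. -/
theorem Bfun_weight_mul {D1 D2 : Set ℂ} (hD1 : IsOpen D1) (hD2 : IsOpen D2) {Z W : ℂ → ℂ}
    (hZ : DifferentiableOn ℂ Z D1) (hZ0 : ∀ z ∈ D1, Z z ≠ 0)
    (hW : DifferentiableOn ℂ W D2) (hW0 : ∀ w ∈ D2, W w ≠ 0) {h : ℂ × ℂ → ℂ}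
    (hh : DifferentiableOn ℂ h (D1 ×ˢ D2)) (hh0 : ∀ p ∈ D1 ×ˢ D2, h p ≠ 0) :
    Set.EqOn (Bfun fun p => Z p.1 * W p.2 * h p) (pw fun p => pz h p / h p) (D1 ×ˢ D2) := by
  have hU := hD1.prod hD2
  have hlog : Set.EqOn
      (fun p => pz (fun p => Z p.1 * W p.2 * h p) p / (Z p.1 * W p.2 * h p))
      (fun p => deriv Z p.1 / Z p.1 + pz h p / h p) (D1 ×ˢ D2) := by
    intro p hp
    have hZp := hZ0 _ hp.1
    have hWp := hW0 _ hp.2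
    have hhp := hh0 p hp
    have h₁ := ((hZ.differentiableAt (hD1.mem_nhds hp.1)).hasDerivAt.hasFDerivAt.comp p
      hasFDerivAt_fst).mul ((hW.differentiableAt (hD2.mem_nhds hp.2)).hasDerivAt.hasFDerivAt.comp p
      hasFDerivAt_snd) |>.mul (hh.differentiableAt (hU.mem_nhds hp)).hasFDerivAt
    have h₂ : pz (fun p => Z p.1 * W p.2 * h p) p =
        Z p.1 * W p.2 * pz h p + h p * (W p.2 * deriv Z p.1) := by
      refine (DFunLike.congr_fun h₁.fderiv ((1 : ℂ), (0 : ℂ))).trans ?_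
      simp [pz]
    simp only [h₂]
    field_simp
    ring
  intro p hp
  refine (pw_congr hU hlog hp).trans ?_
  have h₁ : DifferentiableAt ℂ (fun z => deriv Z z / Z z) p.1 :=
    ((hZ.deriv hD1).differentiableAt (hD1.mem_nhds hp.1)).fun_div
      (hZ.differentiableAt (hD1.mem_nhds hp.1)) (hZ0 _ hp.1)
  have h₂ := h₁.hasFDerivAt.comp p hasFDerivAt_fst
  have h₃ : DifferentiableAt ℂ (fun p => pz h p / h p) p :=
    differentiableAt_div ((differentiableOn_pz hU hh).differentiableAt (hU.mem_nhds hp))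
      (hh.differentiableAt (hU.mem_nhds hp)) (hh0 p hp)
  refine (DFunLike.congr_fun (h₂.add h₃.hasFDerivAt).fderiv ((0 : ℂ), (1 : ℂ))).trans ?_
  simp [pw]

/-- if `a = Z(z)W(w)H_z` and `b = Z(z)W(w)H_w` on a polydisc, with
`A − B` nonvanishing, then `∂_z(ξ/a) = A` and `∂_w(ξ/b) = B` on the polydisc. -/
theorem stmt_6 (D1 D2 : Set ℂ) (hD : IsPolydisc D1 D2)
    (Z W : ℂ → ℂ) (H : ℂ × ℂ → ℂ)
    (hZ : DifferentiableOn ℂ Z D1) (hZ0 : ∀ z ∈ D1, Z z ≠ 0)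
    (hW : DifferentiableOn ℂ W D2) (hW0 : ∀ w ∈ D2, W w ≠ 0)
    (hH : DifferentiableOn ℂ H (D1 ×ˢ D2))
    (hHz : ∀ p ∈ D1 ×ˢ D2, pz H p ≠ 0) (hHw : ∀ p ∈ D1 ×ˢ D2, pw H p ≠ 0)
    (a b : ℂ × ℂ → ℂ)
    (hadef : a = fun p => Z p.1 * W p.2 * pz H p)
    (hbdef : b = fun p => Z p.1 * W p.2 * pw H p)
    (hAB : ∀ p ∈ D1 ×ˢ D2, Afun a p - Bfun b p ≠ 0) :
    ∀ p ∈ D1 ×ˢ D2, pz (fun q => xifun a b q / a q) p = Afun a p ∧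
                    pw (fun q => xifun a b q / b q) p = Bfun b p := by
  have hD12 : IsOpen D1 ∧ IsOpen D2 := by
    obtain ⟨z0, w0, r1, r2, -, -, rfl, rfl⟩ := hD
    exact ⟨Metric.isOpen_ball, Metric.isOpen_ball⟩
  obtain ⟨hD1, hD2⟩ := hD12
  have hU : IsOpen (D1 ×ˢ D2) := hD1.prod hD2
  have ha : ∀ p, a p = Z p.1 * W p.2 * pz H p := fun p => by rw [hadef]
  have hb : ∀ p, b p = Z p.1 * W p.2 * pw H p := fun p => by rw [hbdef]
  have hz := differentiableOn_pz hU hH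
  have hw := differentiableOn_pw hU hH
  have hzw := differentiableOn_pw hU hz
  have hzz := differentiableOn_pz hU hz
  have hww := differentiableOn_pw hU hw
  have hzzw := differentiableOn_pz hU hzw
  have hzww := differentiableOn_pw hU hzw
  have hcomm : Set.EqOn (pz (pw H)) (pw (pz H)) (D1 ×ˢ D2) := pz_pw_comm hU hH
  have hA : Set.EqOn (Afun a) (pz fun p => pw (pz H) p / pz H p) (D1 ×ˢ D2) := by
    rw [hadef]
    exact Afun_weight_mul hD1 hD2 hZ hZ0 hW hW0 hz hHz
  have hB : Set.EqOn (Bfun b) (pw fun p => pw (pz H) p / pw H p) (D1 ×ˢ D2) := by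
    rw [hbdef]
    refine (Bfun_weight_mul hD1 hD2 hZ hZ0 hW hW0 hw hHw).trans (pw_congr hU fun p hp => ?_)
    simp only [hcomm hp]
  have hA' : Set.EqOn (Afun a) (fun p =>
      (pz (pw (pz H)) p * pz H p - pw (pz H) p * pz (pz H) p) / pz H p ^ 2) (D1 ×ˢ D2) :=
    hA.trans fun p hp => fderiv_div_apply (hzw.differentiableAt (hU.mem_nhds hp))
      (hz.differentiableAt (hU.mem_nhds hp)) (hHz p hp) _
  have hB' : Set.EqOn (Bfun b) (fun p =>
      (pw (pw (pz H)) p * pw H p - pw (pz H) p * pw (pw H) p) / pw H p ^ 2) (D1 ×ˢ D2) :=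
    hB.trans fun p hp => fderiv_div_apply (hzw.differentiableAt (hU.mem_nhds hp))
      (hw.differentiableAt (hU.mem_nhds hp)) (hHw p hp) _
  have hrB : Set.EqOn (fun p => b p / a p * Bfun b p) (fun p =>
      (pw (pw (pz H)) p * pw H p - pw (pz H) p * pw (pw H) p) / (pz H p * pw H p))
      (D1 ×ˢ D2) := by
    intro p hp
    have h₁ := hZ0 _ hp.1
    have h₂ := hW0 _ hp.2
    have h₃ := hHz p hp
    have h₄ := hHw p hp
    simp only [hB' hp, ha, hb]
    field_simp
  have hsA : Set.EqOn (fun p => a p / b p * Afun a p) (fun p =>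
      (pz (pw (pz H)) p * pz H p - pw (pz H) p * pz (pz H) p) / (pz H p * pw H p))
      (D1 ×ˢ D2) := by
    intro p hp
    have h₁ := hZ0 _ hp.1
    have h₂ := hW0 _ hp.2
    have h₃ := hHz p hp
    have h₄ := hHw p hp
    simp only [hA' hp, ha, hb]
    field_simp
  have hxi : Set.EqOn (xifun a b) (fun p => Z p.1 * W p.2 * pw (pz H) p) (D1 ×ˢ D2) := by
    intro p hp
    have hUp := hU.mem_nhds hp
    have h₃ := hHz p hp
    have h₄ := hHw p hp
    have dz := hz.differentiableAt hUp
    have dw := hw.differentiableAt hUp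
    have dzw := hzw.differentiableAt hUp
    have dzz := hzz.differentiableAt hUp
    have dww := hww.differentiableAt hUp
    have dzzw := hzzw.differentiableAt hUp
    have dzww := hzww.differentiableAt hUp
    have e₁ : pz (fun q => b q / a q * Bfun b q) p =
        ((pz (pw (pw (pz H))) p * pw H p + pw (pw (pz H)) p * pz (pw H) p -
            (pz (pw (pz H)) p * pw (pw H) p + pw (pz H) p * pz (pw (pw H)) p)) *
            (pz H p * pw H p) -
          (pw (pw (pz H)) p * pw H p - pw (pz H) p * pw (pw H) p) *
            (pz (pz H) p * pw H p + pz H p * pz (pw H) p)) / (pz H p * pw H p) ^ 2 :=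
      (pz_congr hU hrB hp).trans
        (fderiv_mul_sub_mul_div_mul_apply dzww dw dzw dww dz dw h₃ h₄ _)
    have e₂ : pw (fun q => a q / b q * Afun a q) p =
        ((pw (pz (pw (pz H))) p * pz H p + pz (pw (pz H)) p * pw (pz H) p -
            (pw (pw (pz H)) p * pz (pz H) p + pw (pz H) p * pw (pz (pz H)) p)) *
            (pz H p * pw H p) -
          (pz (pw (pz H)) p * pz H p - pw (pz H) p * pz (pz H) p) *
            (pw (pz H) p * pw H p + pz H p * pw (pw H) p)) / (pz H p * pw H p) ^ 2 :=
      (pw_congr hU hsA hp).trans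
        (fderiv_mul_sub_mul_div_mul_apply dzzw dz dzw dzz dz dw h₃ h₄ _)
    have c₁ : pz (pw (pw (pz H))) p = pw (pz (pw (pz H))) p := pz_pw_comm hU hzw hp
    have c₂ : pz (pw (pw H)) p = pw (pw (pz H)) p :=
      (pz_pw_comm hU hw hp).trans (pw_congr hU hcomm hp)
    have c₃ : pw (pz (pz H)) p = pz (pw (pz H)) p := (pz_pw_comm hU hz hp).symm
    simp only [xifun]
    rw [inv_mul_eq_iff_eq_mul₀ (hAB p hp), e₁, e₂, hA' hp, hB' hp, c₁, c₂, c₃, hcomm hp]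
    simp only [ha, hb]
    field_simp
    ring
  intro p hp
  constructor
  · rw [hA hp]
    refine pz_congr hU (fun q hq => ?_) hp
    have h₁ := hZ0 _ hq.1
    have h₂ := hW0 _ hq.2
    have h₃ := hHz q hq
    simp only [hxi hq, ha]
    field_simp
  · rw [hB hp]
    refine pw_congr hU (fun q hq => ?_) hp
    have h₁ := hZ0 _ hq.1
    have h₂ := hW0 _ hq.2
    have h₄ := hHw q hq
    simp only [hxi hq, hb]
    field_simp
end
end

section
/- (Holomorphic Poincaré lemma on a polydisc) Let D = D1 × D2 ⊆ ℂ × ℂ be an open polydisc and let F, G be holomorphic functions on D satisfying F_w = G_z on D. Then there exists a holomorphic function H on D with H_z = F and H_w = G on D. -/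
noncomputable section

/-- A holomorphic 1-form on a complex normed space whose derivative is symmetric has a holomorphic
primitive on every open convex set. -/
theorem exists_hasFDerivAt_of_symmetric {E : Type*} [NormedAddCommGroup E] [NormedSpace ℂ E]
    {s : Set E} (hs : Convex ℝ s) (hso : IsOpen s) {ω : E → E →L[ℂ] ℂ} {dω : E → E →L[ℂ] E →L[ℂ] ℂ}
    (hω : ∀ p ∈ s, HasFDerivAt ω (dω p) p) (hdω : ∀ p ∈ s, ∀ x y, dω p x y = dω p y x) :
    ∃ f : E → ℂ, ∀ p ∈ s, HasFDerivAt f (ω p) p := by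
  obtain ⟨f, hf⟩ := hs.exists_forall_hasFDerivWithinAt_of_hasFDerivWithinAt_symmetric
    (dω := fun p => (dω p).restrictScalars ℝ)
    (fun p hp => ((hω p hp).restrictScalars ℝ).hasFDerivWithinAt)
    (fun p hp x _ y _ => hdω p hp x y)
  exact ⟨f, fun p hp => (hf p hp).hasFDerivAt (hso.mem_nhds hp)⟩

theorem fderiv_apply_eq_pz_add_pw (F : ℂ × ℂ → ℂ) (p x : ℂ × ℂ) :
    fderiv ℂ F p x = x.1 * pz F p + x.2 * pw F p := by
  have hx : x = x.1 • ((1, 0) : ℂ × ℂ) + x.2 • ((0, 1) : ℂ × ℂ) := by ext <;> simp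
  conv_lhs => rw [hx]
  simp only [map_add, map_smul, smul_eq_mul, pz, pw]

/-- holomorphic Poincaré lemma on a polydisc: if `F_w = G_z` on a
polydisc then `F dz + G dw = dH` for some holomorphic `H`. -/
theorem stmt_9 (D1 D2 : Set ℂ) (hD : IsPolydisc D1 D2)
    (F G : ℂ × ℂ → ℂ)
    (hF : DifferentiableOn ℂ F (D1 ×ˢ D2)) (hG : DifferentiableOn ℂ G (D1 ×ˢ D2))
    (hclosed : ∀ p ∈ D1 ×ˢ D2, pw F p = pz G p) :
    ∃ H : ℂ × ℂ → ℂ, DifferentiableOn ℂ H (D1 ×ˢ D2) ∧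
      ∀ p ∈ D1 ×ˢ D2, pz H p = F p ∧ pw H p = G p := by
  obtain ⟨z0, w0, r1, r2, -, -, rfl, rfl⟩ := hD
  have hso : IsOpen (Metric.ball z0 r1 ×ˢ Metric.ball w0 r2) :=
    Metric.isOpen_ball.prod Metric.isOpen_ball
  let ω : ℂ × ℂ → ℂ × ℂ →L[ℂ] ℂ := fun p =>
    F p • ContinuousLinearMap.fst ℂ ℂ ℂ + G p • ContinuousLinearMap.snd ℂ ℂ ℂ
  let dω : ℂ × ℂ → ℂ × ℂ →L[ℂ] ℂ × ℂ →L[ℂ] ℂ := fun p =>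
    (fderiv ℂ F p).smulRight (ContinuousLinearMap.fst ℂ ℂ ℂ) +
      (fderiv ℂ G p).smulRight (ContinuousLinearMap.snd ℂ ℂ ℂ)
  have hω : ∀ p ∈ Metric.ball z0 r1 ×ˢ Metric.ball w0 r2, HasFDerivAt ω (dω p) p := by
    intro p hp
    have hFp := (hF.differentiableAt (hso.mem_nhds hp)).hasFDerivAt
    have hGp := (hG.differentiableAt (hso.mem_nhds hp)).hasFDerivAt
    exact (hFp.smul_const (ContinuousLinearMap.fst ℂ ℂ ℂ)).fun_add
      (hGp.smul_const (ContinuousLinearMap.snd ℂ ℂ ℂ))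
  have hdω : ∀ p ∈ Metric.ball z0 r1 ×ˢ Metric.ball w0 r2, ∀ x y, dω p x y = dω p y x := by
    intro p hp x y
    have hd (u v : ℂ × ℂ) : dω p u v = fderiv ℂ F p u * v.1 + fderiv ℂ G p u * v.2 := rfl
    rw [hd, hd]
    simp only [fderiv_apply_eq_pz_add_pw, hclosed p hp]
    ring
  have hc : Convex ℝ (Metric.ball z0 r1 ×ˢ Metric.ball w0 r2) :=
    (convex_ball z0 r1).prod (convex_ball w0 r2)
  obtain ⟨H, hH⟩ := exists_hasFDerivAt_of_symmetric hc hso hω hdω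
  refine ⟨H, fun p hp => (hH p hp).differentiableAt.differentiableWithinAt, fun p hp => ?_⟩
  simp [pz, pw, (hH p hp).fderiv, ω]
end
end

section
/- Let U ⊆ ℂ × ℂ be open, let f, g be nonvanishing holomorphic functions on U, and define ω1 = (f,0), ω2 = (0,g), ω3 = (−f,−g), Ω = f·g, h1 = −f_w/(fg), h2 = g_z/(fg), F = ∂_z(f_w/f), G = ∂_w(g_z/g), and assume F − G is nonvanishing on U. Set a = −f²g, b = −fg², A = ∂_z(a_w/a), B = ∂_w(b_z/b), ξ = (1/(A−B))·[ a·∂_z((b/a)·B) − b·∂_w((a/b)·A) ], and define Ξ = (1/(F−G))·[ 2·(d(h1·ω2 + 2h2·ω1)/Ω)·dω2 + 2·(d(2h1·ω2 + h2·ω1)/Ω)·dω1 + d(d(h1·ω2 + 2h2·ω1)/Ω)∧ω2 + d(d(2h1·ω2 + h2·ω1)/Ω)∧ω1 ]. Then ξ = f²·g²·Ξ on U. -/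
noncomputable section

/-! Web-theoretic data attached to nonvanishing holomorphic functions `f`, `g`:
`ω1 = f dz`, `ω2 = g dw`, `ω3 = -f dz - g dw`, `Ω = f·g`,
`h1 = -f_w/(fg)`, `h2 = g_z/(fg)`, `h3 = (f_w - g_z)/(fg)`,
`γ = h2·ω1 - h1·ω2`, `F = ∂_z(f_w/f)`, `G = ∂_w(g_z/g)`. -/

def om1 (f g : ℂ × ℂ → ℂ) : Form1 := (f, fun _ => 0)
def om2 (f g : ℂ × ℂ → ℂ) : Form1 := (fun _ => 0, g)
def om3 (f g : ℂ × ℂ → ℂ) : Form1 := (fun p => -f p, fun p => -g p)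
def Om (f g : ℂ × ℂ → ℂ) : ℂ × ℂ → ℂ := fun p => f p * g p
def h1f (f g : ℂ × ℂ → ℂ) : ℂ × ℂ → ℂ := fun p => -(pw f p) / (f p * g p)
def h2f (f g : ℂ × ℂ → ℂ) : ℂ × ℂ → ℂ := fun p => pz g p / (f p * g p)
def h3f (f g : ℂ × ℂ → ℂ) : ℂ × ℂ → ℂ := fun p => (pw f p - pz g p) / (f p * g p)
def gammaF (f g : ℂ × ℂ → ℂ) : Form1 :=
  subF (fsmul (h2f f g) (om1 f g)) (fsmul (h1f f g) (om2 f g))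
def Fcurv (f : ℂ × ℂ → ℂ) : ℂ × ℂ → ℂ := pz (fun p => pw f p / f p)
def Gcurv (g : ℂ × ℂ → ℂ) : ℂ × ℂ → ℂ := pw (fun p => pz g p / g p)

/-- The 1-form `h1·ω2 + 2h2·ω1`. -/
def T1 (f g : ℂ × ℂ → ℂ) : Form1 :=
  addF (fsmul (h1f f g) (om2 f g)) (csmul 2 (fsmul (h2f f g) (om1 f g)))

/-- The 1-form `2h1·ω2 + h2·ω1`. -/
def T2 (f g : ℂ × ℂ → ℂ) : Form1 :=
  addF (csmul 2 (fsmul (h1f f g) (om2 f g))) (fsmul (h2f f g) (om1 f g))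

/-- The function `Ξ` of the paper:
`Ξ = (1/dγ)[ 2(d(h1ω2+2h2ω1)/Ω)dω2 + 2(d(2h1ω2+h2ω1)/Ω)dω1
  + d(d(h1ω2+2h2ω1)/Ω)∧ω2 + d(d(2h1ω2+h2ω1)/Ω)∧ω1 ]`, with `dγ = F - G`. -/
def XiF (f g : ℂ × ℂ → ℂ) : ℂ × ℂ → ℂ := fun p =>
  (Fcurv f p - Gcurv g p)⁻¹ *
    (2 * (dForm (T1 f g) p / Om f g p) * dForm (om2 f g) p +
     2 * (dForm (T2 f g) p / Om f g p) * dForm (om1 f g) p +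
     wedge (dfun (fun q => dForm (T1 f g) q / Om f g q)) (om2 f g) p +
     wedge (dfun (fun q => dForm (T2 f g) q / Om f g q)) (om1 f g) p)

open Set Filter Topology Metric

/-- Directional derivatives of a holomorphic function of several variables are holomorphic. -/
theorem differentiableOn_fderiv_apply {E : Type*} [NormedAddCommGroup E] [NormedSpace ℂ E]
    [FiniteDimensional ℂ E] {f : E → ℂ} {U : Set E} (hU : IsOpen U)
    (hf : DifferentiableOn ℂ f U) (v : E) :
    DifferentiableOn ℂ (fun x => fderiv ℂ f x v) U := by
  intro p hp
  refine DifferentiableAt.differentiableWithinAt ?_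
  have : ProperSpace E := FiniteDimensional.proper ℂ E
  borelize E
  have hbdd : ∀ᶠ x in 𝓝 p, x ∈ U ∧ f x ∈ ball (f p) 1 :=
    (hU.eventually_mem hp).and
      ((hf.continuousOn.continuousAt (hU.mem_nhds hp)).eventually_mem (ball_mem_nhds _ one_pos))
  obtain ⟨ε', hε', hball'⟩ := Metric.eventually_nhds_iff_ball.1 hbdd
  obtain ⟨ε, hε, rfl⟩ : ∃ ε > 0, ε' = 4 * ε := ⟨ε' / 4, by positivity, by ring⟩
  obtain ⟨r, hr, hrv⟩ : ∃ r > 0, r * ‖v‖ ≤ ε := by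
    refine ⟨ε / (‖v‖ + 1), by positivity, ?_⟩
    rw [div_mul_eq_mul_div, div_le_iff₀ (by positivity)]
    nlinarith [norm_nonneg v]
  have hdiff : ∀ y ∈ ball p (4 * ε), DifferentiableAt ℂ f y := fun y hy =>
    hf.differentiableAt (hU.mem_nhds (hball' y hy).1)
  have hfd : ∀ y ∈ ball p (3 * ε), ‖fderiv ℂ f y‖ ≤ 2 / ε := by
    intro y hy
    have hsub : ball y ε ⊆ ball p (4 * ε) :=
      ball_subset_ball' (by rw [mem_ball] at hy; linarith)
    refine Complex.norm_fderiv_le_div_of_mapsTo_ball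
      (fun z hz => (hdiff z (hsub hz)).differentiableWithinAt) (fun z hz => ?_) hε
    have h1 := (hball' z (hsub hz)).2
    have h2 := (hball' y (hsub (mem_ball_self hε))).2
    rw [mem_ball] at h1 h2
    rw [mem_closedBall]
    linarith [dist_triangle_right (f z) (f y) (f p)]
  have hshift : ∀ x ∈ ball p ε, ∀ ζ : ℂ, ‖ζ‖ ≤ r → x + ζ • v ∈ ball p (3 * ε) := by
    intro x hx ζ hζ
    rw [mem_ball, dist_eq_norm] at hx ⊢
    have h1 : ‖ζ • v‖ ≤ ε := by
      rw [norm_smul]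
      exact (mul_le_mul_of_nonneg_right hζ (norm_nonneg v)).trans hrv
    have h2 : x + ζ • v - p = (x - p) + ζ • v := by abel
    rw [h2]
    linarith [norm_add_le (x - p) (ζ • v)]
  have hsub34 : ball p (3 * ε) ⊆ ball p (4 * ε) := ball_subset_ball (by linarith)
  have hcirc : ∀ θ : ℝ, ‖circleMap 0 r θ‖ = r := fun θ => by simp [abs_of_pos hr]
  let k : ℝ → ℂ := fun θ => deriv (circleMap 0 r) θ * (1 / (circleMap 0 r θ) ^ 2)
  have hk : Continuous k := by
    have h0 : ∀ θ, circleMap 0 r θ ^ 2 ≠ 0 := fun θ =>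
      pow_ne_zero 2 (circleMap_ne_center hr.ne')
    simp only [k, deriv_circleMap]
    have := continuous_circleMap 0 r
    fun_prop (disch := exact h0 _)
  have hformula : ∀ x ∈ ball p ε, fderiv ℂ f x v =
      (2 * Real.pi * Complex.I : ℂ)⁻¹ * ∫ θ in (0 : ℝ)..2 * Real.pi,
        k θ * f (x + circleMap 0 r θ • v) := by
    intro x hx
    have hline : ∀ ζ ∈ closedBall (0 : ℂ) r,
        HasDerivAt (fun ζ : ℂ => f (x + ζ • v)) (fderiv ℂ f (x + ζ • v) v) ζ := by
      intro ζ hζ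
      have h1 := (hdiff _ (hsub34 (hshift x hx ζ (by simpa using hζ)))).hasFDerivAt
      have h2 : HasDerivAt (fun ζ : ℂ => x + ζ • v) v ζ := by
        simpa using ((hasDerivAt_id ζ).smul_const v).const_add x
      exact h1.comp_hasDerivAt ζ h2
    have hC := DifferentiableOn.deriv_eq_smul_circleIntegral (c := (0 : ℂ))
      (f := fun ζ : ℂ => f (x + ζ • v)) hr
      (fun ζ hζ => (hline ζ hζ).differentiableAt.differentiableWithinAt)
    rw [(hline 0 (mem_closedBall_self hr.le)).deriv] at hC
    simp only [zero_smul, add_zero, sub_zero, smul_eq_mul] at hC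
    rw [eq_inv_mul_iff_mul_eq₀ Complex.two_pi_I_ne_zero, ← hC, circleIntegral]
    simp only [k, smul_eq_mul, mul_assoc]
  have hcont : ∀ x ∈ ball p ε, Continuous fun θ => k θ * f (x + circleMap 0 r θ • v) := by
    intro x hx
    refine hk.mul (continuous_iff_continuousAt.2 fun θ => ?_)
    refine ContinuousAt.comp (f := fun θ => x + circleMap 0 r θ • v)
      (hdiff _ (hsub34 (hshift x hx _ (hcirc θ).le))).continuousAt ?_
    have := continuous_circleMap 0 r
    fun_prop
  have key := intervalIntegral.hasFDerivAt_integral_of_dominated_of_fderiv_le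
    (𝕜 := ℂ) (μ := MeasureTheory.volume) (a := 0) (b := 2 * Real.pi) (s := ball p ε) (x₀ := p)
    (F := fun x θ => k θ * f (x + circleMap 0 r θ • v))
    (F' := fun x θ => k θ • fderiv ℂ f (x + circleMap 0 r θ • v))
    (bound := fun θ => ‖k θ‖ * (2 / ε))
    (ball_mem_nhds p hε)
    (by filter_upwards [ball_mem_nhds p hε] with x hx using (hcont x hx).aestronglyMeasurable)
    ((hcont p (mem_ball_self hε)).intervalIntegrable _ _)
    (by
      refine hk.aestronglyMeasurable.smul ?_
      have hm : Measurable fun θ : ℝ => fderiv ℂ f (p + circleMap 0 r θ • v) := by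
        refine (measurable_fderiv ℂ f).comp (Continuous.measurable ?_)
        have := continuous_circleMap 0 r
        fun_prop
      exact hm.aestronglyMeasurable)
    (.of_forall fun θ _ x hx => by
      rw [norm_smul]
      exact mul_le_mul_of_nonneg_left (hfd _ (hshift x hx _ (hcirc θ).le)) (norm_nonneg _))
    ((hk.norm.mul continuous_const).intervalIntegrable _ _)
    (.of_forall fun θ _ x hx => by
      have h1 := (hdiff _ (hsub34 (hshift x hx _ (hcirc θ).le))).hasFDerivAt
      exact ((hasFDerivAt_comp_add_right _).2 h1).const_mul (k θ))
  refine (key.differentiableAt.const_mul (2 * Real.pi * Complex.I : ℂ)⁻¹).congr_of_eventuallyEq ?_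
  filter_upwards [ball_mem_nhds p hε] with x hx using hformula x hx

section PartialDerivatives

variable {U : Set (ℂ × ℂ)} {φ ψ : ℂ × ℂ → ℂ} {p : ℂ × ℂ}

theorem DifferentiableOn.pz (hU : IsOpen U) (h : DifferentiableOn ℂ φ U) :
    DifferentiableOn ℂ (pz φ) U :=
  differentiableOn_fderiv_apply hU h (1, 0)

theorem DifferentiableOn.pw (hU : IsOpen U) (h : DifferentiableOn ℂ φ U) :
    DifferentiableOn ℂ (pw φ) U :=
  differentiableOn_fderiv_apply hU h (0, 1)

theorem pz_congr_s14 (hU : IsOpen U) (hp : p ∈ U) (h : EqOn φ ψ U) : pz φ p = pz ψ p := by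
  simp only [pz, (h.eventuallyEq_of_mem (hU.mem_nhds hp)).fderiv_eq]

theorem pw_congr_s14 (hU : IsOpen U) (hp : p ∈ U) (h : EqOn φ ψ U) : pw φ p = pw ψ p := by
  simp only [pw, (h.eventuallyEq_of_mem (hU.mem_nhds hp)).fderiv_eq]

theorem pz_add (hφ : DifferentiableAt ℂ φ p) (hψ : DifferentiableAt ℂ ψ p) :
    pz (fun q => φ q + ψ q) p = pz φ p + pz ψ p := by
  simp [pz, fderiv_fun_add hφ hψ]

theorem pw_add (hφ : DifferentiableAt ℂ φ p) (hψ : DifferentiableAt ℂ ψ p) :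
    pw (fun q => φ q + ψ q) p = pw φ p + pw ψ p := by
  simp [pw, fderiv_fun_add hφ hψ]

theorem pz_neg : pz (fun q => -φ q) p = -pz φ p := by
  simp [pz, fderiv_fun_neg]

theorem pw_neg : pw (fun q => -φ q) p = -pw φ p := by
  simp [pw, fderiv_fun_neg]

theorem pz_const_mul (c : ℂ) (hφ : DifferentiableAt ℂ φ p) :
    pz (fun q => c * φ q) p = c * pz φ p := by
  simp [pz, fderiv_const_mul hφ c]

theorem pw_const_mul (c : ℂ) (hφ : DifferentiableAt ℂ φ p) :
    pw (fun q => c * φ q) p = c * pw φ p := by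
  simp [pw, fderiv_const_mul hφ c]

theorem pz_mul (hφ : DifferentiableAt ℂ φ p) (hψ : DifferentiableAt ℂ ψ p) :
    pz (fun q => φ q * ψ q) p = φ p * pz ψ p + ψ p * pz φ p := by
  simp [pz, fderiv_fun_mul hφ hψ]

theorem pw_mul (hφ : DifferentiableAt ℂ φ p) (hψ : DifferentiableAt ℂ ψ p) :
    pw (fun q => φ q * ψ q) p = φ p * pw ψ p + ψ p * pw φ p := by
  simp [pw, fderiv_fun_mul hφ hψ]

theorem differentiableAt_div_s14 (hφ : DifferentiableAt ℂ φ p) (hψ : DifferentiableAt ℂ ψ p)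
    (h0 : ψ p ≠ 0) : DifferentiableAt ℂ (fun q => φ q / ψ q) p := by
  simp only [div_eq_mul_inv]
  exact hφ.fun_mul (hψ.inv h0)

theorem differentiableOn_div (hφ : DifferentiableOn ℂ φ U) (hψ : DifferentiableOn ℂ ψ U)
    (h0 : ∀ q ∈ U, ψ q ≠ 0) : DifferentiableOn ℂ (fun q => φ q / ψ q) U := by
  simp only [div_eq_mul_inv]
  exact hφ.fun_mul (hψ.inv h0)

theorem pz_div (hφ : DifferentiableAt ℂ φ p) (hψ : DifferentiableAt ℂ ψ p) (h0 : ψ p ≠ 0) :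
    pz (fun q => φ q / ψ q) p = (ψ p * pz φ p - φ p * pz ψ p) / ψ p ^ 2 := by
  have hi := (hasDerivAt_inv h0).comp_hasFDerivAt p hψ.hasFDerivAt
  have h := hφ.hasFDerivAt.mul hi
  simp only [pz, div_eq_mul_inv]
  rw [show (fun q => φ q * (ψ q)⁻¹) = φ * (Inv.inv ∘ ψ) from rfl, h.fderiv]
  simp
  field_simp
  ring

theorem pw_div (hφ : DifferentiableAt ℂ φ p) (hψ : DifferentiableAt ℂ ψ p) (h0 : ψ p ≠ 0) :
    pw (fun q => φ q / ψ q) p = (ψ p * pw φ p - φ p * pw ψ p) / ψ p ^ 2 := by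
  have hi := (hasDerivAt_inv h0).comp_hasFDerivAt p hψ.hasFDerivAt
  have h := hφ.hasFDerivAt.mul hi
  simp only [pw, div_eq_mul_inv]
  rw [show (fun q => φ q * (ψ q)⁻¹) = φ * (Inv.inv ∘ ψ) from rfl, h.fderiv]
  simp
  field_simp
  ring

/-- Mixed partial derivatives of a holomorphic function commute. -/
theorem pz_pw_comm_s14 (hU : IsOpen U) (h : DifferentiableOn ℂ φ U) (hp : p ∈ U) :
    pz (pw φ) p = pw (pz φ) p := by
  have hz := ((h.pz hU).differentiableAt (hU.mem_nhds hp)).hasFDerivAt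
  have hw := ((h.pw hU).differentiableAt (hU.mem_nhds hp)).hasFDerivAt
  have hφ : ∀ᶠ y in 𝓝 p, HasFDerivAt φ
      (pz φ y • ContinuousLinearMap.fst ℂ ℂ ℂ + pw φ y • ContinuousLinearMap.snd ℂ ℂ ℂ) y := by
    filter_upwards [hU.mem_nhds hp] with y hy
    convert (h.differentiableAt (hU.mem_nhds hy)).hasFDerivAt using 1
    ext <;> simp [pz, pw]
  have h2 := (hz.smul_const (ContinuousLinearMap.fst ℂ ℂ ℂ)).add
    (hw.smul_const (ContinuousLinearMap.snd ℂ ℂ ℂ))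
  have h3 := second_derivative_symmetric_of_eventually hφ h2 (1, 0) (0, 1)
  simp only [pz, pw] at h3 ⊢
  simpa using h3

/-- Mixed logarithmic derivatives of a nonvanishing holomorphic function commute. -/
theorem pz_pw_div_self (hU : IsOpen U) (h : DifferentiableOn ℂ φ U) (h0 : ∀ q ∈ U, φ q ≠ 0)
    (hp : p ∈ U) : pz (fun q => pw φ q / φ q) p = pw (fun q => pz φ q / φ q) p := by
  have hn := hU.mem_nhds hp
  rw [pz_div ((h.pw hU).differentiableAt hn) (h.differentiableAt hn) (h0 p hp),
    pw_div ((h.pz hU).differentiableAt hn) (h.differentiableAt hn) (h0 p hp),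
    pz_pw_comm_s14 hU h hp]
  ring

end PartialDerivatives

section WebData

variable {U : Set (ℂ × ℂ)} {f g : ℂ × ℂ → ℂ} {p : ℂ × ℂ}

theorem DifferentiableOn.Fcurv (hU : IsOpen U) (hf : DifferentiableOn ℂ f U)
    (hf0 : ∀ q ∈ U, f q ≠ 0) : DifferentiableOn ℂ (Fcurv f) U :=
  (differentiableOn_div (hf.pw hU) hf hf0).pz hU

theorem DifferentiableOn.Gcurv (hU : IsOpen U) (hg : DifferentiableOn ℂ g U)
    (hg0 : ∀ q ∈ U, g q ≠ 0) : DifferentiableOn ℂ (Gcurv g) U :=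
  (differentiableOn_div (hg.pz hU) hg hg0).pw hU

theorem Afun_neg_sq_mul (hU : IsOpen U) (hf : DifferentiableOn ℂ f U)
    (hg : DifferentiableOn ℂ g U) (hf0 : ∀ q ∈ U, f q ≠ 0) (hg0 : ∀ q ∈ U, g q ≠ 0)
    (hp : p ∈ U) : Afun (fun q => -(f q ^ 2 * g q)) p = 2 * Fcurv f p + Gcurv g p := by
  have hlog : EqOn (fun q => pw (fun q => -(f q ^ 2 * g q)) q / -(f q ^ 2 * g q))
      (fun q => 2 * (pw f q / f q) + pw g q / g q) U := by
    intro q hq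
    have hfq := hf.differentiableAt (hU.mem_nhds hq)
    have hgq := hg.differentiableAt (hU.mem_nhds hq)
    have hf0q := hf0 q hq
    have hg0q := hg0 q hq
    simp only [sq, pw_neg, pw_mul (hfq.fun_mul hfq) hgq, pw_mul hfq hfq]
    field_simp
    ring
  have hu := (differentiableOn_div (hf.pw hU) hf hf0).differentiableAt (hU.mem_nhds hp)
  have hv := (differentiableOn_div (hg.pw hU) hg hg0).differentiableAt (hU.mem_nhds hp)
  rw [Afun, pz_congr_s14 hU hp hlog, pz_add (hu.const_mul 2) hv, pz_const_mul 2 hu,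
    pz_pw_div_self hU hg hg0 hp]
  rfl

theorem Bfun_neg_mul_sq (hU : IsOpen U) (hf : DifferentiableOn ℂ f U)
    (hg : DifferentiableOn ℂ g U) (hf0 : ∀ q ∈ U, f q ≠ 0) (hg0 : ∀ q ∈ U, g q ≠ 0)
    (hp : p ∈ U) : Bfun (fun q => -(f q * g q ^ 2)) p = Fcurv f p + 2 * Gcurv g p := by
  have hlog : EqOn (fun q => pz (fun q => -(f q * g q ^ 2)) q / -(f q * g q ^ 2))
      (fun q => pz f q / f q + 2 * (pz g q / g q)) U := by
    intro q hq
    have hfq := hf.differentiableAt (hU.mem_nhds hq)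
    have hgq := hg.differentiableAt (hU.mem_nhds hq)
    have hf0q := hf0 q hq
    have hg0q := hg0 q hq
    simp only [sq, pz_neg, pz_mul hfq (hgq.fun_mul hgq), pz_mul hgq hgq]
    field_simp
    ring
  have hu := (differentiableOn_div (hf.pz hU) hf hf0).differentiableAt (hU.mem_nhds hp)
  have hv := (differentiableOn_div (hg.pz hU) hg hg0).differentiableAt (hU.mem_nhds hp)
  rw [Bfun, pw_congr_s14 hU hp hlog, pw_add hu (hv.const_mul 2), pw_const_mul 2 hv,
    ← pz_pw_div_self hU hf hf0 hp]
  rfl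

theorem dForm_T1 (hU : IsOpen U) (hg : DifferentiableOn ℂ g U) (hf0 : ∀ q ∈ U, f q ≠ 0) (hg0 : ∀ q ∈ U, g q ≠ 0)
    (hp : p ∈ U) : dForm (T1 f g) p = -(Fcurv f p + 2 * Gcurv g p) := by
  have hz : EqOn (T1 f g).1 (fun q => 2 * (pz g q / g q)) U := by
    intro q hq
    have hf0q := hf0 q hq
    simp only [T1, addF, fsmul, csmul, om1, om2, h2f]
    field_simp
    ring
  have hw : EqOn (T1 f g).2 (fun q => -(pw f q / f q)) U := by
    intro q hq
    have hg0q := hg0 q hq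
    simp only [T1, addF, fsmul, csmul, om1, om2, h1f]
    field_simp
    ring
  have hv := (differentiableOn_div (hg.pz hU) hg hg0).differentiableAt (hU.mem_nhds hp)
  rw [dForm, pz_congr_s14 hU hp hw, pw_congr_s14 hU hp hz, pz_neg, pw_const_mul 2 hv]
  simp only [Fcurv, Gcurv]
  ring!

theorem dForm_T2 (hU : IsOpen U) (hf : DifferentiableOn ℂ f U)
    (hf0 : ∀ q ∈ U, f q ≠ 0) (hg0 : ∀ q ∈ U, g q ≠ 0)
    (hp : p ∈ U) : dForm (T2 f g) p = -(2 * Fcurv f p + Gcurv g p) := by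
  have hz : EqOn (T2 f g).1 (fun q => pz g q / g q) U := by
    intro q hq
    have hf0q := hf0 q hq
    simp only [T2, addF, fsmul, csmul, om1, om2, h2f]
    field_simp
    ring
  have hw : EqOn (T2 f g).2 (fun q => -(2 * (pw f q / f q))) U := by
    intro q hq
    have hg0q := hg0 q hq
    simp only [T2, addF, fsmul, csmul, om1, om2, h1f]
    field_simp
    ring
  have hu := (differentiableOn_div (hf.pw hU) hf hf0).differentiableAt (hU.mem_nhds hp)
  rw [dForm, pz_congr_s14 hU hp hw, pw_congr_s14 hU hp hz, pz_neg, pz_const_mul 2 hu]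
  simp only [Fcurv, Gcurv]
  ring!

end WebData

/-- with `a = -f²g`, `b = -fg²`, the function `ξ` of Theorem 1
coincides with `f²g²·Ξ`. -/
theorem stmt_14 (U : Set (ℂ × ℂ)) (hU : IsOpen U)
    (f g : ℂ × ℂ → ℂ)
    (hf : DifferentiableOn ℂ f U) (hg : DifferentiableOn ℂ g U)
    (hf0 : ∀ p ∈ U, f p ≠ 0) (hg0 : ∀ p ∈ U, g p ≠ 0)
    (hFG : ∀ p ∈ U, Fcurv f p - Gcurv g p ≠ 0)
    (a b : ℂ × ℂ → ℂ)
    (hadef : a = fun p => -(f p ^ 2 * g p))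
    (hbdef : b = fun p => -(f p * g p ^ 2)) :
    ∀ p ∈ U, xifun a b p = f p ^ 2 * g p ^ 2 * XiF f g p := by
  subst hadef hbdef
  intro p hp
  have hn := hU.mem_nhds hp
  have hfp := hf.differentiableAt hn
  have hgp := hg.differentiableAt hn
  have hF := (hf.Fcurv hU hf0).differentiableAt hn
  have hG := (hg.Gcurv hU hg0).differentiableAt hn
  have hf0p := hf0 p hp
  have hg0p := hg0 p hp
  have hA := fun q (hq : q ∈ U) => Afun_neg_sq_mul hU hf hg hf0 hg0 hq
  have hB := fun q (hq : q ∈ U) => Bfun_neg_mul_sq hU hf hg hf0 hg0 hq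
  have hT1 := fun q (hq : q ∈ U) => dForm_T1 hU hg hf0 hg0 hq
  have hT2 := fun q (hq : q ∈ U) => dForm_T2 hU hf hf0 hg0 hq
  have hξz : EqOn (fun q => -(f q * g q ^ 2) / -(f q ^ 2 * g q) *
      Bfun (fun q => -(f q * g q ^ 2)) q)
      (fun q => g q / f q * (Fcurv f q + 2 * Gcurv g q)) U := by
    intro q hq
    have hf0q := hf0 q hq
    have hg0q := hg0 q hq
    simp only [hB q hq]
    field_simp
  have hξw : EqOn (fun q => -(f q ^ 2 * g q) / -(f q * g q ^ 2) *
      Afun (fun q => -(f q ^ 2 * g q)) q)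
      (fun q => f q / g q * (2 * Fcurv f q + Gcurv g q)) U := by
    intro q hq
    have hf0q := hf0 q hq
    have hg0q := hg0 q hq
    simp only [hA q hq]
    field_simp
  have hΞz : EqOn (fun q => dForm (T1 f g) q / Om f g q)
      (fun q => -((Fcurv f q + 2 * Gcurv g q) / (f q * g q))) U := by
    intro q hq
    simp only [hT1 q hq, Om, neg_div]
  have hΞw : EqOn (fun q => dForm (T2 f g) q / Om f g q)
      (fun q => -((2 * Fcurv f q + Gcurv g q) / (f q * g q))) U := by
    intro q hq
    simp only [hT2 q hq, Om, neg_div]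
  have hconst : pw (fun _ => 0) p = 0 ∧ pz (fun _ => 0) p = 0 := by simp [pw, pz]
  have hS1 := hF.fun_add (hG.const_mul 2)
  have hS2 := (hF.const_mul 2).fun_add hG
  simp only [xifun, XiF, wedge, dfun]
  rw [hA p hp, hB p hp, hT1 p hp, hT2 p hp, pz_congr_s14 hU hp hξz, pw_congr_s14 hU hp hξw,
    pz_congr_s14 hU hp hΞz, pw_congr_s14 hU hp hΞw]
  simp only [om1, om2, dForm, Om, hconst]
  rw [pz_neg, pw_neg,
    pz_div hS1 (hfp.fun_mul hgp) (mul_ne_zero hf0p hg0p),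
    pw_div hS2 (hfp.fun_mul hgp) (mul_ne_zero hf0p hg0p),
    pz_mul (differentiableAt_div_s14 hgp hfp hf0p) hS1, pw_mul (differentiableAt_div_s14 hfp hgp hg0p) hS2,
    pz_mul hfp hgp, pw_mul hfp hgp, pz_div hgp hfp hf0p, pw_div hfp hgp hg0p]
  have hcurv : 2 * Fcurv f p + Gcurv g p - (Fcurv f p + 2 * Gcurv g p) =
      Fcurv f p - Gcurv g p := by ring
  have hFGp := hFG p hp
  rw [hcurv]
  field_simp
  ring
end
end
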